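/- Let k be a totally real number field of degree d over ℚ and ℓ a totally complex quadratic extension of k. For every odd integer n ≥ 3, the product ∏_{j=1}^{(n−1)/2} ζ_k(2j) · ζ_ℓ(2j+1)/ζ_k(2j+1) is strictly greater than ∏_{j=1}^{(n−1)/2} ζ(2dj)^{1/2}. -/

import Mathlib

open NumberField

/-- The Dedekind zeta function of a number field `K`, evaluated at a real argument `s`:
`ζ_K(s) = ∑_{I ≠ 0} (N I)^{-s}`, the sum running over the nonzero ideals of the ring of
integers of `K`. -/
noncomputable def dedekindZetaReal (K : Type*) [Field K] [NumberField K] (s : ℝ) : ℝ :=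
  ∑' I : {I : Ideal (𝓞 K) // I ≠ ⊥}, (Ideal.absNorm I.1 : ℝ) ^ (-s)

/-- The Riemann zeta function at a real argument `s`: `ζ(s) = ∑_{n ≥ 1} n^{-s}`. -/
noncomputable def riemannZetaReal (s : ℝ) : ℝ :=
  ∑' n : ℕ+, (n : ℝ) ^ (-s)

open Filter in
/-- Convergence of the Dedekind zeta series for `s > 1`. -/
theorem dzr_summable (K : Type*) [Field K] [NumberField K] (s : ℝ) (hs : 1 < s) :
    Summable (fun I : {I : Ideal (𝓞 K) // I ≠ ⊥} => (Ideal.absNorm I.1 : ℝ) ^ (-s)) := by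
  have hO : (fun n : ℕ => ∑ m ∈ Finset.Icc 1 n,
      (Nat.card {I : Ideal (𝓞 K) // Ideal.absNorm I = m} : ℝ)) =O[atTop]
      fun n => (n : ℝ) ^ (1 : ℝ) := by
    refine Asymptotics.isBigO_atTop_natCast_rpow_of_tendsto_div_rpow (𝕜 := ℝ)
      (a := dedekindZeta_residue K) ?_
    refine ((Ideal.tendsto_norm_le_div_atTop₀ K).comp tendsto_natCast_atTop_atTop).congr
      fun n ↦ ?_
    simp only [Function.comp_apply, Nat.cast_le, ← Nat.cast_sum, Real.rpow_one]
    congr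
    rw [← add_left_inj 1, ← Ideal.card_norm_le_eq_card_norm_le_add_one,
      show Finset.Icc 1 n = Finset.Ioc 0 n from Finset.Icc_succ_left_eq_Ioc _ _,
      show 1 = Nat.card {I : Ideal (𝓞 K) // Ideal.absNorm I = 0} by
        simp [Ideal.absNorm_eq_zero_iff],
      Finset.sum_Ioc_add_eq_sum_Icc (n.zero_le),
      ← Finset.card_preimage_eq_sum_card_image_eq
        (fun k _ ↦ Ideal.finite_setOfPred_absNorm_eq k)]
    simp [Set.coe_eq_subtype]
  have hL := LSeriesSummable_of_sum_norm_bigO_and_nonneg (s := (s : ℂ)) hO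
    (fun _ => Nat.cast_nonneg _) zero_le_one (by simpa using hs)
  have hL' := hL.norm
  rw [← (Equiv.sigmaFiberEquiv
    (fun I : {I : Ideal (𝓞 K) // I ≠ ⊥} => Ideal.absNorm I.1)).summable_iff,
    summable_sigma_of_nonneg (fun _ => by simp only [Function.comp_apply]; positivity)]
  have hfin : ∀ m : ℕ, Finite {I : {I : Ideal (𝓞 K) // I ≠ ⊥} // Ideal.absNorm I.1 = m} := by
    intro m
    have : Finite {I : Ideal (𝓞 K) // Ideal.absNorm I = m} :=
      Ideal.finite_setOfPred_absNorm_eq m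
    exact Finite.of_injective
      (fun I : {I : {I : Ideal (𝓞 K) // I ≠ ⊥} // Ideal.absNorm I.1 = m} =>
        (⟨I.1.1, I.2⟩ : {I : Ideal (𝓞 K) // Ideal.absNorm I = m}))
      (fun a b h => Subtype.ext (Subtype.ext (Subtype.mk.inj h)))
  refine ⟨fun m => Summable.of_finite, ?_⟩
  refine Summable.of_nonneg_of_le (fun m => tsum_nonneg fun _ => by
    simp only [Function.comp_apply]; positivity) (fun m => ?_) hL'
  have e1 : ∀ I : {I : {I : Ideal (𝓞 K) // I ≠ ⊥} // Ideal.absNorm I.1 = m},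
      ((fun I : {I : Ideal (𝓞 K) // I ≠ ⊥} => (Ideal.absNorm I.1 : ℝ) ^ (-s)) ∘
        (Equiv.sigmaFiberEquiv
          (fun I : {I : Ideal (𝓞 K) // I ≠ ⊥} => Ideal.absNorm I.1))) ⟨m, I⟩
        = (m : ℝ) ^ (-s) := by
    intro I
    simp [Equiv.sigmaFiberEquiv, I.2]
  rw [tsum_congr e1, tsum_const, nsmul_eq_mul]
  rcases Nat.eq_zero_or_pos m with rfl | hm
  · have : IsEmpty {I : {I : Ideal (𝓞 K) // I ≠ ⊥} // Ideal.absNorm I.1 = 0} :=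
      ⟨fun I => I.1.2 (Ideal.absNorm_eq_zero_iff.mp I.2)⟩
    simp
  · rw [LSeries.norm_term_eq, if_neg hm.ne']
    simp only [Complex.ofReal_re, Complex.norm_real, Real.norm_natCast,
      Real.rpow_neg (Nat.cast_nonneg m), div_eq_mul_inv]
    refine mul_le_mul_of_nonneg_right ?_ (by positivity)
    have : Finite {I : Ideal (𝓞 K) // Ideal.absNorm I = m} :=
      Ideal.finite_setOfPred_absNorm_eq m
    exact_mod_cast Nat.card_le_card_of_injective
      (fun I : {I : {I : Ideal (𝓞 K) // I ≠ ⊥} // Ideal.absNorm I.1 = m} =>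
        (⟨I.1.1, I.2⟩ : {I : Ideal (𝓞 K) // Ideal.absNorm I = m}))
      (fun a b h => Subtype.ext (Subtype.ext (Subtype.mk.inj h)))

/-- `ζ_K(s) > 1`. -/
theorem dzr_gt_one (K : Type*) [Field K] [NumberField K] (s : ℝ) (hs : 1 < s) :
    1 < dedekindZetaReal K s := by
  have h2 : (Ideal.span {(2 : 𝓞 K)}) ≠ ⊥ := by simp
  have hne : (Ideal.span {((2 : ℕ) : 𝓞 K)}) ≠ ⊤ := by
    rw [Ne, ← Ideal.absNorm_eq_one_iff, Ideal.absNorm_span_natCast]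
    have : 0 < Module.finrank ℤ (𝓞 K) := by
      rw [RingOfIntegers.rank]; exact Module.finrank_pos
    exact (Nat.one_lt_pow this.ne' (by norm_num)).ne'
  have htop : (⊤ : Ideal (𝓞 K)) ≠ ⊥ := top_ne_bot
  have := (dzr_summable K s hs).sum_le_tsum
    {⟨⊤, htop⟩, ⟨Ideal.span {(2 : 𝓞 K)}, h2⟩} (fun _ _ => by positivity)
  rw [Finset.sum_pair (by
    intro h; exact hne (by simpa using (congrArg Subtype.val h).symm))] at this
  have hpos : 0 < (Ideal.absNorm (Ideal.span {(2 : 𝓞 K)}) : ℝ) ^ (-s) := by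
    apply Real.rpow_pos_of_pos
    exact_mod_cast Nat.pos_of_ne_zero (by rwa [Ne, Ideal.absNorm_eq_zero_iff])
  simp only [Ideal.absNorm_top, Nat.cast_one, Real.one_rpow] at this
  unfold dedekindZetaReal
  linarith

/-- `ζ(d s) ≤ ζ_K(s)`, by looking at the ideals generated by positive integers. -/
theorem rzr_le_dzr (K : Type*) [Field K] [NumberField K] (s : ℝ) (hs : 1 < s) :
    riemannZetaReal (Module.finrank ℚ K * s) ≤ dedekindZetaReal K s := by
  have hn : ∀ n : ℕ+, Ideal.absNorm (Ideal.span {((n : ℕ) : 𝓞 K)}) =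
      (n : ℕ) ^ Module.finrank ℚ K := by
    intro n
    rw [Ideal.absNorm_span_natCast, RingOfIntegers.rank]
  let f : ℕ+ → {I : Ideal (𝓞 K) // I ≠ ⊥} := fun n =>
    ⟨Ideal.span {((n : ℕ) : 𝓞 K)}, by simp⟩
  have hf : Function.Injective f := by
    intro a b h
    have h1 := congrArg (fun I => Ideal.absNorm I.1) h
    simp only [f, hn] at h1
    exact PNat.coe_injective (Nat.pow_left_injective (Module.finrank_pos).ne' h1)
  have hS := dzr_summable K s hs
  have e : ∀ n : ℕ+, ((n : ℕ) : ℝ) ^ (-((Module.finrank ℚ K : ℝ) * s)) =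
      (Ideal.absNorm (f n).1 : ℝ) ^ (-s) := by
    intro n
    simp only [f, hn]
    rw [Nat.cast_pow, ← Real.rpow_natCast, ← Real.rpow_mul (Nat.cast_nonneg _), mul_neg]
  unfold riemannZetaReal dedekindZetaReal
  refine Summable.tsum_le_tsum_of_inj f hf (fun _ _ => by positivity) (fun n => (e n).le) ?_ hS
  exact (hS.comp_injective hf).congr fun n => (e n).symm

/-- `ζ_K(s+1)^2 ≤ ζ_K(s)`: the number of divisors of an ideal is at most its norm. -/
theorem dzr_sq_le (K : Type*) [Field K] [NumberField K] (s : ℝ) (hs : 1 < s) :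
    dedekindZetaReal K (s + 1) * dedekindZetaReal K (s + 1) ≤ dedekindZetaReal K s := by
  have hS := dzr_summable K s hs
  have hS1 := dzr_summable K (s + 1) (by linarith)
  have hfin : ∀ I : {I : Ideal (𝓞 K) // I ≠ ⊥}, Finite (𝓞 K ⧸ I.1) := fun I =>
    (Ideal.absNorm_ne_zero_iff I.1).mp (by rw [Ne, Ideal.absNorm_eq_zero_iff]; exact I.2)
  let g : (Σ I : {I : Ideal (𝓞 K) // I ≠ ⊥}, 𝓞 K ⧸ I.1) → ℝ :=
    fun x => (Ideal.absNorm x.1.1 : ℝ) ^ (-(s + 1))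
  have hinner : ∀ I : {I : Ideal (𝓞 K) // I ≠ ⊥}, ∑' x : 𝓞 K ⧸ I.1, g ⟨I, x⟩ =
      (Ideal.absNorm I.1 : ℝ) ^ (-s) := by
    intro I
    have hpos : (0 : ℝ) < Ideal.absNorm I.1 := by
      exact_mod_cast Nat.pos_of_ne_zero (by rw [Ne, Ideal.absNorm_eq_zero_iff]; exact I.2)
    have hc : Nat.card (𝓞 K ⧸ I.1) = Ideal.absNorm I.1 := rfl
    simp only [g]
    rw [tsum_const, nsmul_eq_mul, hc]
    nth_rewrite 1 [← Real.rpow_one (Ideal.absNorm I.1 : ℝ)]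
    rw [← Real.rpow_add hpos]
    congr 1; ring
  have hg : Summable g := by
    rw [summable_sigma_of_nonneg (fun _ => by simp only [g]; positivity)]
    exact ⟨fun I => Summable.of_finite, hS.congr fun I => (hinner I).symm⟩
  have htot : ∑' x, g x = dedekindZetaReal K s := by
    rw [hg.tsum_sigma]
    exact tsum_congr hinner
  have hne : ∀ p : {I : Ideal (𝓞 K) // I ≠ ⊥} × {I : Ideal (𝓞 K) // I ≠ ⊥},
      p.1.1 * p.2.1 ≠ ⊥ := fun p => mul_ne_zero p.1.2 p.2.2
  have hex : ∀ p : {I : Ideal (𝓞 K) // I ≠ ⊥} × {I : Ideal (𝓞 K) // I ≠ ⊥},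
      ∃ a, p.1.1 * p.2.1 ⊔ Ideal.span {a} = p.1.1 := fun p =>
    IsDedekindDomain.exists_sup_span_eq Ideal.mul_le_left (hne p)
  choose a ha using hex
  let f : {I : Ideal (𝓞 K) // I ≠ ⊥} × {I : Ideal (𝓞 K) // I ≠ ⊥} →
      (Σ I : {I : Ideal (𝓞 K) // I ≠ ⊥}, 𝓞 K ⧸ I.1) :=
    fun p => ⟨⟨p.1.1 * p.2.1, hne p⟩, Ideal.Quotient.mk _ (a p)⟩
  have hleft : ∀ p, Ideal.comap (Ideal.Quotient.mk (f p).1.1) (Ideal.span {(f p).2}) = p.1.1 := by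
    intro p
    simp only [f]
    rw [← Set.image_singleton, ← Ideal.map_span,
      Ideal.comap_map_of_surjective _ Ideal.Quotient.mk_surjective]
    rw [← RingHom.ker_eq_comap_bot, Ideal.mk_ker, sup_comm]
    exact ha p
  have hf : Function.Injective f := by
    intro p q h
    have h1 : p.1.1 = q.1.1 := by rw [← hleft p, ← hleft q, h]
    have h2 : p.1.1 * p.2.1 = q.1.1 * q.2.1 := congrArg (fun x => x.1.1) h
    rw [h1] at h2
    exact Prod.ext (Subtype.ext h1) (Subtype.ext (mul_left_cancel₀ q.1.2 h2))
  have hprod := hS1.mul_of_nonneg hS1 (fun _ => by positivity) (fun _ => by positivity)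
  rw [← htot]
  unfold dedekindZetaReal
  rw [hS1.tsum_mul_tsum hS1 hprod]
  refine Summable.tsum_le_tsum_of_inj f hf (fun _ _ => by simp only [g]; positivity)
    (fun p => ?_) hprod hg
  simp only [f, g, map_mul, Nat.cast_mul]
  rw [Real.mul_rpow (Nat.cast_nonneg _) (Nat.cast_nonneg _)]

/-- Let `k` be a totally real number field of degree `d` over `ℚ` and `ℓ` a totally complex
quadratic extension of `k`. For every odd integer `n ≥ 3`,
`∏_{j=1}^{(n−1)/2} ζ_k(2j) · ζ_ℓ(2j+1)/ζ_k(2j+1) > ∏_{j=1}^{(n−1)/2} ζ(2dj)^{1/2}`. -/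
theorem stmt_3 (k ℓ : Type*) [Field k] [NumberField k] [Field ℓ] [NumberField ℓ]
    [Algebra k ℓ] (hquad : Module.finrank k ℓ = 2)
    (hreal : ∀ v : InfinitePlace k, v.IsReal)
    (hcomplex : ∀ w : InfinitePlace ℓ, w.IsComplex)
    (d : ℕ) (hd : Module.finrank ℚ k = d)
    (n : ℕ) (hn : Odd n) (hn3 : 3 ≤ n) :
    ∏ j ∈ Finset.Icc 1 ((n - 1) / 2),
        dedekindZetaReal k (2 * j) *
          (dedekindZetaReal ℓ (2 * j + 1) / dedekindZetaReal k (2 * j + 1)) >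
      ∏ j ∈ Finset.Icc 1 ((n - 1) / 2), Real.sqrt (riemannZetaReal (2 * d * j)) := by
  refine Finset.prod_lt_prod_of_nonempty (fun j hj => ?_) (fun j hj => ?_) ?_
  · apply Real.sqrt_pos.mpr
    have hj1 : (1 : ℝ) ≤ j := by exact_mod_cast (Finset.mem_Icc.mp hj).1
    have hd0 : (1 : ℝ) ≤ d := by
      have : 0 < Module.finrank ℚ k := Module.finrank_pos
      rw [hd] at this
      exact_mod_cast this
    have hS : Summable (fun n : ℕ+ => ((n : ℕ) : ℝ) ^ (-(2 * (d : ℝ) * j))) :=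
      (Real.summable_nat_rpow.mpr (by nlinarith)).comp_injective PNat.coe_injective
    exact hS.tsum_pos (fun _ => by positivity) 1 (by simp)
  · have hj1 : (1 : ℝ) ≤ j := by exact_mod_cast (Finset.mem_Icc.mp hj).1
    have hs : (1 : ℝ) < 2 * j := by linarith
    have h1 := dzr_gt_one k (2 * j) hs
    have h2 := dzr_gt_one k (2 * j + 1) (by linarith)
    have h3 := dzr_gt_one ℓ (2 * j + 1) (by linarith)
    have h4 := dzr_sq_le k (2 * j) hs
    have h5 := rzr_le_dzr k (2 * j) hs
    rw [hd, show (d : ℝ) * (2 * j) = 2 * d * j by ring] at h5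
    refine (Real.sqrt_le_sqrt h5).trans_lt ?_
    set Z := dedekindZetaReal k (2 * j)
    set T := dedekindZetaReal k (2 * j + 1)
    set L := dedekindZetaReal ℓ (2 * j + 1)
    have h6 : T ≤ Real.sqrt Z := Real.le_sqrt_of_sq_le (by nlinarith)
    have h7 : Real.sqrt Z * Real.sqrt Z = Z := Real.mul_self_sqrt (by linarith)
    rw [← mul_div_assoc, lt_div_iff₀ (by linarith)]
    nlinarith
  · exact ⟨1, Finset.mem_Icc.mpr ⟨le_rfl, by omega⟩⟩
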